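/- Let ψ₁, ψ₂ ∈ 𝓢(ℝ,ℝ) and φ = ψ₁ ⋆ ψ₂ with ∫_ℝ φ(p)² dp = 1, and let L > 0 satisfy ∫_ℝ (φ(x−p) − φ(y−p))² dp ≤ L(x−y)² for all x,y ∈ ℝ. Let α > 0 and let a : ℝ × [0,1] → ℝ be measurable with ∫₀¹∫_ℝ a(p,s)² dp ds ≤ 2α. Let f : ℝ × [0,1] → ℝ be measurable and satisfy f(u,t) = u + ∫₀ᵗ ∫_ℝ φ(f(u,s)−p) a(p,s) dp ds for all u ∈ ℝ, t ∈ [0,1]. Fix m ≥ 1 and let h : ℝ × [0,1] → ℝ be measurable with h(u,0) = u and, for every k = 0,…,m−1 and t ∈ [k/m,(k+1)/m], h(u,t) = h(u,k/m) + ∫_{k/m}^{t} ∫_ℝ φ(h(u,k/m)−p) a(p,s) dp ds. Then for every t ∈ [0,1], ∫_ℝ (f(u,t) − h(u,t))² μ(du) ≤ (4 L α² / m) · e^{2Lα}. -/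

import Mathlib

open MeasureTheory Filter Topology ProbabilityTheory
open scoped ENNReal

noncomputable section

/-- The standard Gaussian measure on `ℝ`. -/
def gaussMeasure : Measure ℝ := gaussianReal 0 1

/-- Convolution on `ℝ`: `(f ⋆ g)(x) = ∫ f(x−t) g(t) dt`. -/
def conv (f g : ℝ → ℝ) : ℝ → ℝ :=
  fun x => ∫ t : ℝ, f (x - t) * g t


lemma cs_aux {X : Type*} [MeasurableSpace X] (ν : Measure X) (g a : X → ℝ)
    (hgm : AEStronglyMeasurable g ν) (ham : AEStronglyMeasurable a ν)
    (hg : Integrable (fun x => g x ^ 2) ν) (ha : Integrable (fun x => a x ^ 2) ν) :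
    Integrable (fun x => g x * a x) ν ∧
      (∫ x, g x * a x ∂ν) ^ 2 ≤ (∫ x, g x ^ 2 ∂ν) * ∫ x, a x ^ 2 ∂ν := by
  have hga : Integrable (fun x => g x * a x) ν := by
    refine (hg.add ha).mono (hgm.mul ham) (Eventually.of_forall fun x => ?_)
    simp only [Pi.add_apply, Real.norm_eq_abs]
    rw [abs_of_nonneg (by positivity : 0 ≤ g x ^ 2 + a x ^ 2), abs_le]
    constructor <;> nlinarith [sq_nonneg (g x + a x), sq_nonneg (g x - a x)]
  refine ⟨hga, ?_⟩
  have key : ∀ y : ℝ, 0 ≤ (∫ x, a x ^ 2 ∂ν) * (y * y) + (2 * ∫ x, g x * a x ∂ν) * y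
      + ∫ x, g x ^ 2 ∂ν := by
    intro y
    have h1 : 0 ≤ ∫ x, (a x ^ 2 * (y * y) + g x * a x * (2 * y)) + g x ^ 2 ∂ν := by
      apply integral_nonneg
      intro x
      show 0 ≤ (a x ^ 2 * (y * y) + g x * a x * (2 * y)) + g x ^ 2
      nlinarith [sq_nonneg (g x + y * a x)]
    rw [integral_add ((ha.mul_const _).fun_add (hga.mul_const _)) hg,
      integral_add (ha.mul_const _) (hga.mul_const _), integral_mul_const,
      integral_mul_const] at h1
    linarith
  have := discrim_le_zero key
  unfold discrim at this
  nlinarith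

lemma ac_exp {β : ℝ → ℝ} {c d : ℝ} (hβ : AbsolutelyContinuousOnInterval β c d)
    (hneg : ∀ x ∈ Set.uIcc c d, β x ≤ 0) :
    AbsolutelyContinuousOnInterval (fun x => Real.exp (β x)) c d := by
  have hexp : ∀ x ≤ (0:ℝ), ∀ y ≤ (0:ℝ), |Real.exp x - Real.exp y| ≤ |x - y| := by
    have : ∀ x ≤ (0:ℝ), ∀ y ≤ x, |Real.exp x - Real.exp y| ≤ |x - y| := by
      intro x hx y hy
      rw [abs_of_nonneg (by linarith [Real.exp_le_exp.2 hy]), abs_of_nonneg (by linarith)]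
      have h1 : Real.exp y = Real.exp x * Real.exp (y - x) := by rw [← Real.exp_add]; ring_nf
      have h2 := Real.add_one_le_exp (y - x)
      have h3 := Real.exp_le_one_iff.2 hx
      have h4 := Real.exp_pos x
      rw [h1]
      nlinarith
    intro x hx y hy
    rcases le_total y x with h | h
    · exact this x hx y h
    · rw [abs_sub_comm, abs_sub_comm x]; exact this y hy x h
  rw [absolutelyContinuousOnInterval_iff] at hβ ⊢
  intro ε hε
  obtain ⟨δ, hδ, h⟩ := hβ ε hε
  refine ⟨δ, hδ, fun E hE hs => lt_of_le_of_lt (Finset.sum_le_sum fun i hi => ?_) (h E hE hs)⟩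
  have := hE.1 i hi
  simp only [Real.dist_eq]
  exact hexp _ (hneg _ this.1) _ (hneg _ this.2)

lemma gron (b E : ℝ → ℝ) (c d l e0 : ℝ) (hcd : c ≤ d) (hl : 0 ≤ l)
    (hb0 : ∀ s, 0 ≤ b s) (hb : IntervalIntegrable b volume c d)
    (hE : ContinuousOn E (Set.Icc c d))
    (hle : ∀ t ∈ Set.Icc c d, E t ≤ e0 + l * ∫ s in c..t, b s * (E s + ∫ r in c..s, b r)) :
    E d ≤ (e0 + l * (∫ s in c..d, b s) ^ 2 / 2) * Real.exp (l * ∫ s in c..d, b s) := by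
  set β : ℝ → ℝ := fun t => ∫ s in c..t, b s with hβ
  have hβac : AbsolutelyContinuousOnInterval β c d :=
    hb.absolutelyContinuousOnInterval_intervalIntegral (by simp)
  have hu : Set.uIcc c d = Set.Icc c d := Set.uIcc_of_le hcd
  have hβ0 : ∀ t ∈ Set.Icc c d, 0 ≤ β t := fun t ht =>
    intervalIntegral.integral_nonneg ht.1 fun s _ => hb0 s
  have hbE : IntervalIntegrable (fun s => b s * (E s + β s)) volume c d := by
    apply hb.mul_continuousOn
    rw [hu]
    exact hE.add (hu ▸ hβac.continuousOn)
  set G0 : ℝ → ℝ := fun t => ∫ s in c..t, b s * (E s + β s) with hG0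
  have hGac : AbsolutelyContinuousOnInterval G0 c d :=
    hbE.absolutelyContinuousOnInterval_intervalIntegral (by simp)
  have hXac : AbsolutelyContinuousOnInterval (fun t => Real.exp (-l * β t)) c d := by
    apply ac_exp (hβac.const_mul (-l))
    intro x hx
    rw [hu] at hx
    nlinarith [hβ0 x hx]
  have hcac : AbsolutelyContinuousOnInterval (fun _ : ℝ => e0) c d :=
    (LipschitzWith.const e0).lipschitzOnWith.absolutelyContinuousOnInterval
  have hHac := (((hcac.fun_add (hGac.const_mul l)).fun_mul hXac).fun_sub
    ((hβac.fun_mul hβac).const_mul (l / 2)))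
  have h1 := hHac.integral_deriv_eq_sub
  have h2 : ∫ x in c..d, deriv (fun x => (e0 + l * G0 x) * Real.exp (-l * β x) -
      l / 2 * (β x * β x)) x ≤ ∫ x in c..d, (0:ℝ) := by
    apply intervalIntegral.integral_mono_ae_restrict hcd hHac.intervalIntegrable_deriv (by simp)
    rw [EventuallyLE, ae_restrict_iff' measurableSet_Icc]
    filter_upwards [hb.ae_hasDerivAt_integral, hbE.ae_hasDerivAt_integral] with x hx1 hx2 hx
    have d1 : HasDerivAt β (b x) x := hx1 (hu ▸ hx) c (by simp)
    have d2 : HasDerivAt G0 (b x * (E x + β x)) x := hx2 (hu ▸ hx) c (by simp)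
    have d3 := (((d2.const_mul l).const_add e0).mul ((d1.const_mul (-l)).exp)).sub
      ((d1.mul d1).const_mul (l / 2))
    have := hβ0 x hx
    have h4 := hle x hx
    have h5 : Real.exp (-l * β x) ≤ 1 := Real.exp_le_one_iff.2 (by nlinarith)
    have h6 := Real.exp_pos (-l * β x)
    have h7 : E x ≤ e0 + l * G0 x := h4
    have h8 := hb0 x
    refine le_trans (le_of_eq d3.deriv) ?_
    have e1 : 0 ≤ l * b x * Real.exp (-l * β x) * (e0 + l * G0 x - E x) := by
      apply mul_nonneg (by positivity); linarith
    have e2 : 0 ≤ l * b x * β x * (1 - Real.exp (-l * β x)) := by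
      apply mul_nonneg (by positivity); linarith
    nlinarith
  have hGc : G0 c = 0 := by simp [hG0]
  have hβc : β c = 0 := by simp [hβ]
  rw [h1, hGc, hβc] at h2
  simp at h2
  have h3 : E d ≤ e0 + l * G0 d := hle d ⟨hcd, le_rfl⟩
  have h9 : (e0 + l * G0 d) * Real.exp (-(l * β d)) ≤ e0 + l * β d ^ 2 / 2 := by
    rw [pow_two]; linarith
  calc E d ≤ e0 + l * G0 d := h3
    _ = (e0 + l * G0 d) * Real.exp (-(l * β d)) * Real.exp (l * β d) := by
      rw [mul_assoc, ← Real.exp_add]; simp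
    _ ≤ _ := by gcongr

lemma core (V : ℝ → ℝ → ℝ) (b : ℝ → ℝ) (hb0 : ∀ s, 0 ≤ b s) (hbm : Measurable b)
    (l : ℝ) (hl : 0 ≤ l)
    (hb2 : IntegrableOn (fun s => b s ^ 2) (Set.Icc 0 1))
    (hV1 : ∀ᵐ s ∂(volume.restrict (Set.Icc (0:ℝ) 1)), ∀ x, |V x s| ≤ b s)
    (hV2 : ∀ᵐ s ∂(volume.restrict (Set.Icc (0:ℝ) 1)), ∀ x y,
      |V x s - V y s| ≤ l * |x - y| * b s)
    (hVm : ∀ g : ℝ → ℝ, Measurable g → Measurable (fun s => V (g s) s))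
    (f h : ℝ → ℝ) (hfm : Measurable f) (u : ℝ)
    (hf : ∀ t ∈ Set.Icc (0 : ℝ) 1, f t = u + ∫ s in (0 : ℝ)..t, V (f s) s)
    (m : ℕ) (hm : 1 ≤ m) (hh0 : h 0 = u)
    (hh : ∀ k : ℕ, k < m → ∀ t ∈ Set.Icc ((k : ℝ) / m) (((k : ℝ) + 1) / m),
        h t = h ((k : ℝ) / m) + ∫ s in ((k : ℝ) / m)..t, V (h ((k : ℝ) / m)) s) :
    ∀ t ∈ Set.Icc (0 : ℝ) 1, |f t - h t| ≤
      l / (2 * m) * (∫ s in (0:ℝ)..t, b s ^ 2) * Real.exp (l * ∫ s in (0:ℝ)..t, b s) := by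
  have hm0 : (0:ℝ) < m := by exact_mod_cast hm
  have hbI : IntegrableOn b (Set.Icc 0 1) := by
    have := (cs_aux (volume.restrict (Set.Icc (0:ℝ) 1)) b (fun _ => 1)
      hbm.aestronglyMeasurable aestronglyMeasurable_const hb2 (by simp)).1
    simp only [mul_one] at this
    exact this
  have sub : ∀ c d : ℝ, 0 ≤ c → c ≤ d → d ≤ 1 → Set.uIoc c d ⊆ Set.Icc 0 1 := by
    intro c d hc hcd hd x hx
    rw [Set.uIoc_of_le hcd] at hx
    exact ⟨by linarith [hx.1], by linarith [hx.2]⟩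
  have hbi : ∀ c d : ℝ, 0 ≤ c → c ≤ d → d ≤ 1 → IntervalIntegrable b volume c d := by
    intro c d hc hcd hd
    rw [intervalIntegrable_iff]
    exact hbI.mono_set (sub c d hc hcd hd)
  have hb2i : ∀ c d : ℝ, 0 ≤ c → c ≤ d → d ≤ 1 →
      IntervalIntegrable (fun s => b s ^ 2) volume c d := by
    intro c d hc hcd hd
    rw [intervalIntegrable_iff]
    exact hb2.mono_set (sub c d hc hcd hd)
  have hVI : ∀ g : ℝ → ℝ, Measurable g → IntegrableOn (fun s => V (g s) s) (Set.Icc 0 1) := by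
    intro g hg
    refine Integrable.mono hbI (hVm g hg).aestronglyMeasurable ?_
    filter_upwards [hV1] with s hs
    rw [Real.norm_eq_abs, Real.norm_eq_abs, abs_of_nonneg (hb0 s)]
    exact hs _
  have hVi : ∀ g : ℝ → ℝ, Measurable g → ∀ c d : ℝ, 0 ≤ c → c ≤ d → d ≤ 1 →
      IntervalIntegrable (fun s => V (g s) s) volume c d := by
    intro g hg c d hc hcd hd
    rw [intervalIntegrable_iff]
    exact (hVI g hg).mono_set (sub c d hc hcd hd)
  have hres : ∀ c d : ℝ, 0 ≤ c → d ≤ 1 →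
      volume.restrict (Set.Icc c d) ≤ volume.restrict (Set.Icc (0:ℝ) 1) := by
    intro c d hc hd
    exact Measure.restrict_mono (Set.Icc_subset_Icc hc hd) le_rfl
  have step : ∀ k : ℕ, k < m →
      |f ((k:ℝ) / m) - h ((k:ℝ) / m)| ≤ l / (2 * m) * (∫ s in (0:ℝ)..((k:ℝ) / m), b s ^ 2) *
        Real.exp (l * ∫ s in (0:ℝ)..((k:ℝ) / m), b s) →
      ∀ t ∈ Set.Icc ((k : ℝ) / m) (((k : ℝ) + 1) / m), |f t - h t| ≤
        l / (2 * m) * (∫ s in (0:ℝ)..t, b s ^ 2) * Real.exp (l * ∫ s in (0:ℝ)..t, b s) := by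
    intro k hk hek t ht
    have hhk := hh k hk
    set c : ℝ := (k:ℝ) / m with hc
    have hc0 : 0 ≤ c := by positivity
    have hd1 : ((k:ℝ) + 1) / m ≤ 1 := by
      rw [div_le_one hm0]; exact_mod_cast hk
    have hct : c ≤ t := ht.1
    have ht1 : t ≤ 1 := ht.2.trans hd1
    have htc : t - c ≤ 1 / m := by
      have : ((k:ℝ) + 1) / m = c + 1 / m := by rw [hc]; ring
      linarith [ht.2]
    have hfd : ∀ s ∈ Set.Icc c t, f s = f c + ∫ r in c..s, V (f r) r := by
      intro s hs
      rw [hf s ⟨hc0.trans hs.1, hs.2.trans ht1⟩, hf c ⟨hc0, hct.trans ht1⟩, add_assoc,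
        intervalIntegral.integral_add_adjacent_intervals
          (hVi f hfm 0 c le_rfl hc0 (hct.trans ht1)) (hVi f hfm c s hc0 hs.1 (hs.2.trans ht1))]
    have hhd : ∀ s ∈ Set.Icc c t, h s = h c + ∫ r in c..s, V (h c) r := by
      intro s hs
      exact hhk s ⟨hs.1, hs.2.trans ht.2⟩
    have contI : ∀ g : ℝ → ℝ, Measurable g →
        ContinuousOn (fun s => ∫ r in c..s, V (g r) r) (Set.Icc c t) := by
      intro g hg
      have := ((hVi g hg c t hc0 hct ht1).absolutelyContinuousOnInterval_intervalIntegral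
        (c := c) (by simp)).continuousOn
      rwa [Set.uIcc_of_le hct] at this
    have hE : ContinuousOn (fun s => |f s - h s|) (Set.Icc c t) := by
      refine (ContinuousOn.sub ?_ ?_).abs
      · exact (continuousOn_const.add (contI f hfm)).congr hfd
      · exact (continuousOn_const.add (contI (fun _ => h c) measurable_const)).congr hhd
    have hβc : ContinuousOn (fun s => ∫ r in c..s, b r) (Set.Icc c t) := by
      have := ((hbi c t hc0 hct ht1).absolutelyContinuousOnInterval_intervalIntegral
        (c := c) (by simp)).continuousOn
      rwa [Set.uIcc_of_le hct] at this
    have hhb : ∀ s ∈ Set.Icc c t, |h s - h c| ≤ ∫ r in c..s, b r := by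
      intro s hs
      rw [hhd s hs, add_sub_cancel_left]
      refine (intervalIntegral.abs_integral_le_integral_abs hs.1).trans ?_
      apply intervalIntegral.integral_mono_ae_restrict hs.1
        (hVi (fun _ => h c) measurable_const c s hc0 hs.1 (hs.2.trans ht1)).abs
        (hbi c s hc0 hs.1 (hs.2.trans ht1))
      filter_upwards [ae_mono (hres c s hc0 (hs.2.trans ht1)) hV1] with r hr
      exact hr _
    have hle : ∀ s ∈ Set.Icc c t, |f s - h s| ≤ |f c - h c| +
        l * ∫ r in c..s, b r * (|f r - h r| + ∫ q in c..r, b q) := by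
      intro s hs
      have hs1 := hs.2.trans ht1
      have e1 : f s - h s = (f c - h c) + ∫ r in c..s, (V (f r) r - V (h c) r) := by
        rw [intervalIntegral.integral_sub (hVi f hfm c s hc0 hs.1 hs1)
          (hVi (fun _ => h c) measurable_const c s hc0 hs.1 hs1), hfd s hs, hhd s hs]
        ring
      rw [e1]
      refine (abs_add_le _ _).trans ?_
      gcongr
      rw [← intervalIntegral.integral_const_mul]
      refine (intervalIntegral.abs_integral_le_integral_abs hs.1).trans ?_
      apply intervalIntegral.integral_mono_ae_restrict hs.1
        ((hVi f hfm c s hc0 hs.1 hs1).sub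
          (hVi (fun _ => h c) measurable_const c s hc0 hs.1 hs1)).abs
      · apply IntervalIntegrable.const_mul
        apply (hbi c s hc0 hs.1 hs1).mul_continuousOn
        rw [Set.uIcc_of_le hs.1]
        exact (hE.add hβc).mono (Set.Icc_subset_Icc le_rfl hs.2)
      · filter_upwards [ae_mono (hres c s hc0 hs1) hV2,
          ae_restrict_mem measurableSet_Icc] with r hr hrm
        refine (hr _ _).trans ?_
        have hrm' : r ∈ Set.Icc c t := ⟨hrm.1, hrm.2.trans hs.2⟩
        have e2 : |f r - h c| ≤ |f r - h r| + ∫ q in c..r, b q := by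
          have := hhb r hrm'
          have e3 := abs_sub_le (f r) (h r) (h c)
          linarith
        have := hb0 r
        calc l * |f r - h c| * b r ≤ l * (|f r - h r| + ∫ q in c..r, b q) * b r := by gcongr
          _ = _ := by ring
    have hg := gron b (fun s => |f s - h s|) c t l (|f c - h c|) hct hl hb0
      (hbi c t hc0 hct ht1) hE hle
    have hB : ∫ s in (0:ℝ)..t, b s = (∫ s in (0:ℝ)..c, b s) + ∫ s in c..t, b s :=
      (intervalIntegral.integral_add_adjacent_intervals (hbi 0 c le_rfl hc0 (hct.trans ht1))
        (hbi c t hc0 hct ht1)).symm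
    have hA : ∫ s in (0:ℝ)..t, b s ^ 2 = (∫ s in (0:ℝ)..c, b s ^ 2) + ∫ s in c..t, b s ^ 2 :=
      (intervalIntegral.integral_add_adjacent_intervals (hb2i 0 c le_rfl hc0 (hct.trans ht1))
        (hb2i c t hc0 hct ht1)).symm
    have hcs : (∫ s in c..t, b s) ^ 2 ≤ (1 / m) * ∫ s in c..t, b s ^ 2 := by
      have := (cs_aux (volume.restrict (Set.Ioc c t)) b (fun _ => 1)
        hbm.aestronglyMeasurable aestronglyMeasurable_const
        ((intervalIntegrable_iff_integrableOn_Ioc_of_le hct).1 (hb2i c t hc0 hct ht1))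
        (by simp)).2
      rw [← intervalIntegral.integral_of_le hct, ← intervalIntegral.integral_of_le hct,
        ← intervalIntegral.integral_of_le hct] at this
      simp only [mul_one, one_pow, intervalIntegral.integral_const, smul_eq_mul] at this
      have h0 : 0 ≤ ∫ s in c..t, b s ^ 2 :=
        intervalIntegral.integral_nonneg hct fun s _ => sq_nonneg _
      nlinarith
    have hB0 : 0 ≤ ∫ s in (0:ℝ)..c, b s :=
      intervalIntegral.integral_nonneg hc0 fun s _ => hb0 s
    have hA0 : 0 ≤ ∫ s in c..t, b s ^ 2 :=
      intervalIntegral.integral_nonneg hct fun s _ => sq_nonneg _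
    rw [hA, hB, mul_add l, Real.exp_add, ← mul_assoc]
    refine hg.trans ?_
    gcongr
    have x1 : 1 ≤ Real.exp (l * ∫ s in (0:ℝ)..c, b s) := Real.one_le_exp (by positivity)
    have x2 : l * (∫ s in c..t, b s) ^ 2 / 2 ≤ l / (2 * m) * (∫ s in c..t, b s ^ 2) := by
      calc _ ≤ l * ((1 / m) * ∫ s in c..t, b s ^ 2) / 2 := by gcongr
        _ = _ := by field_simp
    have x3 : 0 ≤ l / (2 * m) * (∫ s in c..t, b s ^ 2) := by positivity
    nlinarith
  have hQ : ∀ k : ℕ, k ≤ m →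
      |f ((k:ℝ) / m) - h ((k:ℝ) / m)| ≤ l / (2 * m) * (∫ s in (0:ℝ)..((k:ℝ) / m), b s ^ 2) *
        Real.exp (l * ∫ s in (0:ℝ)..((k:ℝ) / m), b s) := by
    intro k
    induction k with
    | zero =>
      intro _
      have := hf 0 (by simp)
      simp at this
      simp [this, hh0]
    | succ k ih =>
      intro hk
      have := step k hk (ih (by omega)) (((k:ℝ) + 1) / m) ⟨by gcongr; linarith, le_rfl⟩
      push_cast
      exact this
  intro t ht
  rcases eq_or_lt_of_le ht.2 with h1 | h1
  · have := hQ m le_rfl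
    rw [div_self hm0.ne'] at this
    rw [h1]; exact this
  · have hk : ⌊(m:ℝ) * t⌋₊ < m := by
      rw [Nat.floor_lt (mul_nonneg hm0.le ht.1)]
      nlinarith
    refine step _ hk (hQ _ hk.le) t ⟨?_, ?_⟩
    · rw [div_le_iff₀ hm0, mul_comm t]
      exact Nat.floor_le (mul_nonneg hm0.le ht.1)
    · rw [le_div_iff₀ hm0, mul_comm t]
      exact (Nat.lt_floor_add_one _).le

/-- **Euler-scheme approximation bound.** If `f` solves the characteristic equation
driven by `a` and `h` is its time-discretization with mesh `1/m`, then
`∫ (f(u,t) − h(u,t))² μ(du) ≤ (4Lα²/m) e^{2Lα}` for all `t ∈ [0,1]`. -/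
theorem euler_scheme_gaussian_L2_bound
    (ψ₁ ψ₂ : SchwartzMap ℝ ℝ) (φ : ℝ → ℝ) (hφ : φ = conv (⇑ψ₁) (⇑ψ₂))
    (hφnorm : ∫ p : ℝ, φ p ^ 2 = 1)
    (L : ℝ) (hL : 0 < L)
    (hLip : ∀ x y : ℝ, (∫ p : ℝ, (φ (x - p) - φ (y - p)) ^ 2) ≤ L * (x - y) ^ 2)
    (α : ℝ) (hα : 0 < α)
    (a : ℝ → ℝ → ℝ) (ham : Measurable (Function.uncurry a))
    (ha : (∫⁻ s in Set.Icc (0 : ℝ) 1, ∫⁻ p, ENNReal.ofReal (a p s ^ 2)) ≤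
      ENNReal.ofReal (2 * α))
    (f : ℝ → ℝ → ℝ) (hfm : Measurable (Function.uncurry f))
    (hf : ∀ u : ℝ, ∀ t ∈ Set.Icc (0 : ℝ) 1,
      f u t = u + ∫ s in (0 : ℝ)..t, ∫ p : ℝ, φ (f u s - p) * a p s)
    (m : ℕ) (hm : 1 ≤ m)
    (h : ℝ → ℝ → ℝ) (hhm : Measurable (Function.uncurry h))
    (hh0 : ∀ u : ℝ, h u 0 = u)
    (hh : ∀ u : ℝ, ∀ k : ℕ, k < m →
      ∀ t ∈ Set.Icc ((k : ℝ) / m) (((k : ℝ) + 1) / m),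
        h u t = h u ((k : ℝ) / m) +
          ∫ s in ((k : ℝ) / m)..t, ∫ p : ℝ, φ (h u ((k : ℝ) / m) - p) * a p s) :
    ∀ t ∈ Set.Icc (0 : ℝ) 1,
      (∫⁻ u, ENNReal.ofReal ((f u t - h u t) ^ 2) ∂gaussMeasure) ≤
        ENNReal.ofReal (4 * L * α ^ 2 / m * Real.exp (2 * L * α)) := by
  have hφm : Measurable φ := by
    rw [hφ]
    have : StronglyMeasurable (fun x => ∫ t : ℝ, ψ₁ (x - t) * ψ₂ t) := by
      apply StronglyMeasurable.integral_prod_right (f := fun x t => ψ₁ (x - t) * ψ₂ t)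
      apply Continuous.stronglyMeasurable
      have h1 := ψ₁.continuous
      have h2 := ψ₂.continuous
      unfold Function.uncurry
      fun_prop
    exact this.measurable
  have hφ2 : Integrable (fun p => φ p ^ 2) := by
    by_contra hcon
    rw [integral_undef hcon] at hφnorm
    norm_num at hφnorm
  have hφx : ∀ x, Integrable (fun p => φ (x - p) ^ 2) := fun x => hφ2.comp_sub_left x
  have hφxm : ∀ x, AEStronglyMeasurable (fun p => φ (x - p)) volume := fun x =>
    (hφm.comp (measurable_const.sub measurable_id)).aestronglyMeasurable
  have hφx1 : ∀ x, ∫ p, φ (x - p) ^ 2 = 1 := fun x => by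
    rw [integral_sub_left_eq_self (fun p => φ p ^ 2) volume x, hφnorm]
  set V : ℝ → ℝ → ℝ := fun x s => ∫ p : ℝ, φ (x - p) * a p s with hV
  set b : ℝ → ℝ := fun s => √(∫ p, a p s ^ 2) with hb
  have hb0 : ∀ s, 0 ≤ b s := fun s => Real.sqrt_nonneg _
  have hasq : ∀ s, 0 ≤ ∫ p, a p s ^ 2 := fun s => integral_nonneg fun p => sq_nonneg _
  have hb2 : ∀ s, b s ^ 2 = ∫ p, a p s ^ 2 := fun s => Real.sq_sqrt (hasq s)
  have ham' : Measurable (fun q : ℝ × ℝ => a q.2 q.1) := ham.comp measurable_swap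
  have hbm : Measurable b := by
    apply Measurable.sqrt
    have : StronglyMeasurable (fun s => ∫ p, a p s ^ 2) := by
      apply StronglyMeasurable.integral_prod_right (f := fun s p => a p s ^ 2)
      exact (ham'.pow_const 2).stronglyMeasurable
    exact this.measurable
  have has : ∀ s, Measurable (fun p => a p s) := fun s => ham.comp measurable_prodMk_right
  have hlm : Measurable (fun s => ∫⁻ p, ENNReal.ofReal (a p s ^ 2)) :=
    Measurable.lintegral_prod_right' (f := fun q : ℝ × ℝ => ENNReal.ofReal (a q.2 q.1 ^ 2))
      (ham'.pow_const 2).ennreal_ofReal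
  have hai : ∀ᵐ s ∂(volume.restrict (Set.Icc (0:ℝ) 1)), Integrable (fun p => a p s ^ 2) := by
    have := ae_lt_top hlm (ne_top_of_le_ne_top ENNReal.ofReal_ne_top ha)
    filter_upwards [this] with s hs
    refine ⟨((has s).pow_const 2).aestronglyMeasurable, ?_⟩
    rw [hasFiniteIntegral_iff_ofReal (Eventually.of_forall fun p => sq_nonneg _)]
    exact hs
  have hbl : (∫⁻ s in Set.Icc (0:ℝ) 1, ENNReal.ofReal (b s ^ 2)) ≤ ENNReal.ofReal (2 * α) := by
    refine le_trans (lintegral_mono_ae ?_) ha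
    filter_upwards [hai] with s hs
    rw [hb2, ofReal_integral_eq_lintegral_ofReal hs (Eventually.of_forall fun p => sq_nonneg _)]
  have hbI : IntegrableOn (fun s => b s ^ 2) (Set.Icc 0 1) := by
    refine ⟨(hbm.pow_const 2).aestronglyMeasurable, ?_⟩
    rw [hasFiniteIntegral_iff_ofReal (Eventually.of_forall fun p => sq_nonneg _)]
    exact lt_of_le_of_lt hbl ENNReal.ofReal_lt_top
  have hbA : ∫ s in Set.Icc (0:ℝ) 1, b s ^ 2 ≤ 2 * α := by
    rw [integral_eq_lintegral_of_nonneg_ae (Eventually.of_forall fun p => sq_nonneg _)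
      (hbm.pow_const 2).aestronglyMeasurable]
    exact ENNReal.toReal_le_of_le_ofReal (by positivity) hbl
  have hV1 : ∀ᵐ s ∂(volume.restrict (Set.Icc (0:ℝ) 1)), ∀ x, |V x s| ≤ b s := by
    filter_upwards [hai] with s hs x
    have := (cs_aux volume (fun p => φ (x - p)) (fun p => a p s) (hφxm x)
      (has s).aestronglyMeasurable (hφx x) hs).2
    rw [hφx1, one_mul] at this
    exact Real.abs_le_sqrt this
  have hV2 : ∀ᵐ s ∂(volume.restrict (Set.Icc (0:ℝ) 1)), ∀ x y,
      |V x s - V y s| ≤ √L * |x - y| * b s := by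
    filter_upwards [hai] with s hs x y
    have ix := (cs_aux volume (fun p => φ (x - p)) (fun p => a p s) (hφxm x)
      (has s).aestronglyMeasurable (hφx x) hs).1
    have iy := (cs_aux volume (fun p => φ (y - p)) (fun p => a p s) (hφxm y)
      (has s).aestronglyMeasurable (hφx y) hs).1
    have ixy := (cs_aux volume (fun p => φ (x - p)) (fun p => φ (y - p)) (hφxm x)
      (hφxm y) (hφx x) (hφx y)).1
    have i2 : Integrable (fun p => (φ (x - p) - φ (y - p)) ^ 2) := by
      refine (((hφx x).sub (ixy.const_mul 2)).add (hφx y)).congr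
        (Eventually.of_forall fun p => ?_)
      simp only [Pi.add_apply, Pi.sub_apply]
      ring
    have := (cs_aux volume (fun p => φ (x - p) - φ (y - p)) (fun p => a p s)
      ((hφxm x).sub (hφxm y)) (has s).aestronglyMeasurable i2 hs).2
    have e : V x s - V y s = ∫ p, (φ (x - p) - φ (y - p)) * a p s := by
      simp only [hV]
      rw [← integral_sub ix iy]
      congr 1; ext p; ring
    rw [e]
    apply abs_le_of_sq_le_sq _ (by have := hb0 s; positivity)
    rw [mul_pow, mul_pow, sq_abs, Real.sq_sqrt hL.le, hb2]
    exact this.trans (mul_le_mul_of_nonneg_right (hLip x y) (hasq s))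
  have hVm : ∀ g : ℝ → ℝ, Measurable g → Measurable (fun s => V (g s) s) := by
    intro g hg
    have : StronglyMeasurable (fun s => ∫ p, φ (g s - p) * a p s) := by
      apply StronglyMeasurable.integral_prod_right (f := fun s p => φ (g s - p) * a p s)
      exact ((hφm.comp ((hg.comp measurable_fst).sub measurable_snd)).mul ham').stronglyMeasurable
    exact this.measurable
  have hm0 : (1:ℝ) ≤ m := by exact_mod_cast hm
  have hbI0 : IntervalIntegrable (fun s => b s ^ 2) volume 0 1 := by
    rw [intervalIntegrable_iff_integrableOn_Icc_of_le zero_le_one]; exact hbI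
  have hcs := cs_aux (volume.restrict (Set.Ioc (0:ℝ) 1)) b (fun _ => 1)
    hbm.aestronglyMeasurable aestronglyMeasurable_const
    ((intervalIntegrable_iff_integrableOn_Ioc_of_le zero_le_one).1 hbI0) (by simp)
  have hA1 : ∫ s in (0:ℝ)..1, b s ^ 2 ≤ 2 * α := by
    rw [intervalIntegral.integral_of_le zero_le_one, ← integral_Icc_eq_integral_Ioc]
    exact hbA
  have hbi0 : IntervalIntegrable b volume 0 1 := by
    rw [intervalIntegrable_iff_integrableOn_Ioc_of_le zero_le_one]
    have := hcs.1
    simp only [mul_one] at this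
    exact this
  have hB1 : ∫ s in (0:ℝ)..1, b s ≤ √(2 * α) := by
    apply Real.le_sqrt_of_sq_le
    have := hcs.2
    rw [← intervalIntegral.integral_of_le zero_le_one,
      ← intervalIntegral.integral_of_le zero_le_one,
      ← intervalIntegral.integral_of_le zero_le_one] at this
    simp only [mul_one, one_pow, intervalIntegral.integral_const, smul_eq_mul, sub_zero] at this
    linarith
  intro t ht
  have hpt : ∀ u, (f u t - h u t) ^ 2 ≤ 4 * L * α ^ 2 / m * Real.exp (2 * L * α) := by
    intro u
    have h1 := core V b hb0 hbm (√L) (Real.sqrt_nonneg _) hbI hV1 hV2 hVm (f u) (h u)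
      (hfm.comp measurable_prodMk_left) u (hf u) m hm (hh0 u) (hh u) t ht
    have hAt : ∫ s in (0:ℝ)..t, b s ^ 2 ≤ 2 * α := by
      refine le_trans ?_ hA1
      exact intervalIntegral.integral_mono_interval le_rfl ht.1 ht.2
        (Eventually.of_forall fun s => sq_nonneg _) hbI0
    have hBt : ∫ s in (0:ℝ)..t, b s ≤ √(2 * α) := by
      refine le_trans ?_ hB1
      exact intervalIntegral.integral_mono_interval le_rfl ht.1 ht.2
        (Eventually.of_forall fun s => hb0 s) hbi0
    have h2 : |f u t - h u t| ≤ √L / (2 * m) * (2 * α) * Real.exp (√L * √(2 * α)) := by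
      refine h1.trans ?_
      gcongr
    have h3 : (f u t - h u t) ^ 2 ≤ (√L / (2 * m) * (2 * α) * Real.exp (√L * √(2 * α))) ^ 2 := by
      rw [← sq_abs]
      gcongr
    refine h3.trans ?_
    have h4 : (√L / (2 * m) * (2 * α) * Real.exp (√L * √(2 * α))) ^ 2 =
        L * α ^ 2 / m ^ 2 * Real.exp (2 * (√L * √(2 * α))) := by
      rw [mul_pow, ← Real.exp_nat_mul, mul_pow, div_pow, Real.sq_sqrt hL.le]
      push_cast
      field_simp
    rw [h4]
    have h5 : (√L * √(2 * α)) ^ 2 = 2 * L * α := by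
      rw [mul_pow, Real.sq_sqrt hL.le, Real.sq_sqrt (by positivity)]; ring
    have h6 : Real.exp (2 * (√L * √(2 * α))) ≤ 4 * Real.exp (2 * L * α) := by
      have : Real.exp (2 * (√L * √(2 * α))) ≤ Real.exp (1 + 2 * L * α) := by
        apply Real.exp_le_exp.2
        nlinarith [sq_nonneg (√L * √(2 * α) - 1)]
      refine this.trans ?_
      rw [Real.exp_add]
      have := Real.exp_one_lt_d9
      gcongr
      linarith
    have h7 : L * α ^ 2 / (m:ℝ) ^ 2 ≤ L * α ^ 2 / m := by
      gcongr
      nlinarith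
    calc _ ≤ L * α ^ 2 / m * (4 * Real.exp (2 * L * α)) := by gcongr
      _ = _ := by ring
  calc _ ≤ ∫⁻ u, ENNReal.ofReal (4 * L * α ^ 2 / m * Real.exp (2 * L * α)) ∂gaussMeasure :=
        lintegral_mono fun u => ENNReal.ofReal_le_ofReal (hpt u)
    _ = _ := by
      rw [lintegral_const, gaussMeasure, measure_univ, mul_one]

end
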